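/- (First-order bold self-energy coefficient) Let U(x) = (1/8) Σ_{i,j=1}^n v_{ij} x_i² x_j² be a quartic interaction with symmetric coefficient matrix v such that U has superquadratic growth. Fix a symmetric positive definite n×n matrix G. Then the first coefficient of the asymptotic series of ε ↦ Σ[G; εU] at ε = 0 is given entrywise by (Σ^(1)[G])_{ij} = -½ (Σ_k v_{ik} G_{kk}) δ_{ij} - v_{ij} G_{ij}. -/

import Mathlib

open MeasureTheory Matrix Filter Topology Real Asymptotics

attribute [local instance] Matrix.normedAddCommGroup Matrix.normedSpace

noncomputable section

/-- The partition function `Z[A] = ∫ exp(-½ xᵀAx - U(x)) dx`. -/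
def Zfun (n : ℕ) (U : (Fin n → ℝ) → ℝ) (A : Matrix (Fin n) (Fin n) ℝ) : ℝ :=
  ∫ x : Fin n → ℝ, Real.exp (-(1 / 2) * (x ⬝ᵥ A.mulVec x) - U x)

/-- The free energy `Ω[A] = -log Z[A]`. -/
def Omega (n : ℕ) (U : (Fin n → ℝ) → ℝ) (A : Matrix (Fin n) (Fin n) ℝ) : ℝ :=
  - Real.log (Zfun n U A)

/-- `U` is continuous with superquadratic growth: for every `c > 0`,
`U x - c * |x|² → +∞` as `|x| → ∞`. -/
def SuperQuadratic {n : ℕ} (U : (Fin n → ℝ) → ℝ) : Prop :=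
  Continuous U ∧ ∀ c : ℝ, 0 < c →
    Tendsto (fun x : Fin n → ℝ => U x - c * ‖x‖ ^ 2) (cocompact _) atTop

/-- A probability density on `ℝⁿ` with finite second moments and finite
differential entropy. -/
def IsGoodDensity {n : ℕ} (ρ : (Fin n → ℝ) → ℝ) : Prop :=
  Measurable ρ ∧ (∀ x, 0 ≤ ρ x) ∧ (∫ x, ρ x) = 1 ∧
  (∀ i j : Fin n, Integrable fun x => x i * x j * ρ x) ∧
  Integrable fun x => ρ x * Real.log (ρ x)

/-- Differential entropy `S(ρ) = -∫ ρ log ρ`. -/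
def entropy {n : ℕ} (ρ : (Fin n → ℝ) → ℝ) : ℝ := - ∫ x, ρ x * Real.log (ρ x)

/-- Second-moment matrix `𝒢(ρ) = ∫ x xᵀ ρ(x) dx`. -/
def momMatrix {n : ℕ} (ρ : (Fin n → ℝ) → ℝ) : Matrix (Fin n) (Fin n) ℝ :=
  Matrix.of fun i j => ∫ x, x i * x j * ρ x

/-- `𝓕[G;U] = sup { S(ρ) - ∫ U ρ : ρ ∈ 𝓜, 𝒢(ρ) = G }`. -/
def Ffun (n : ℕ) (U : (Fin n → ℝ) → ℝ) (G : Matrix (Fin n) (Fin n) ℝ) : ℝ :=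
  sSup { r : ℝ | ∃ ρ : (Fin n → ℝ) → ℝ, IsGoodDensity ρ ∧
    (Integrable fun x => U x * ρ x) ∧ momMatrix ρ = G ∧
    r = entropy ρ - ∫ x, U x * ρ x }

/-- The Luttinger-Ward functional `Φ[G;U] = 2𝓕[G;U] - Tr[log G] - n log(2πe)`.
(For positive definite `G`, `Tr[log G] = log det G`.) -/
def Phi (n : ℕ) (U : (Fin n → ℝ) → ℝ) (G : Matrix (Fin n) (Fin n) ℝ) : ℝ :=
  2 * Ffun n U G - Real.log G.det - (n : ℝ) * Real.log (2 * π * Real.exp 1)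

/-- The continuous linear functional `H ↦ Tr[S * H]` on matrices. -/
def tracePairing {n : ℕ} (S : Matrix (Fin n) (Fin n) ℝ) :
    Matrix (Fin n) (Fin n) ℝ →L[ℝ] ℝ :=
  LinearMap.toContinuousLinearMap
    { toFun := fun H => (S * H).trace
      map_add' := fun H K => by simp [Matrix.mul_add]
      map_smul' := fun c H => by simp [Matrix.mul_smul] }


/-- Continuous and polynomially bounded functions. -/
def PB {n : ℕ} (f : (Fin n → ℝ) → ℝ) : Prop :=
  Continuous f ∧ ∃ (C : ℝ) (k : ℕ), 0 ≤ C ∧ ∀ x, |f x| ≤ C * (1 + ‖x‖) ^ k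

lemma PB.const {n : ℕ} (c : ℝ) : PB (fun _ : Fin n → ℝ => c) :=
  ⟨continuous_const, |c|, 0, abs_nonneg _, fun x => by simp⟩

lemma PB.coord {n : ℕ} (i : Fin n) : PB (fun x : Fin n → ℝ => x i) :=
  ⟨continuous_apply i, 1, 1, zero_le_one, fun x => by
    have := norm_le_pi_norm x i
    rw [Real.norm_eq_abs] at this
    simp; linarith⟩

lemma PB.mul {n : ℕ} {f g : (Fin n → ℝ) → ℝ} (hf : PB f) (hg : PB g) :
    PB (fun x => f x * g x) := by
  obtain ⟨hfc, C, k, hC, hf⟩ := hf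
  obtain ⟨hgc, D, l, hD, hg⟩ := hg
  refine ⟨hfc.mul hgc, C * D, k + l, mul_nonneg hC hD, fun x => ?_⟩
  rw [abs_mul, pow_add]
  calc _ ≤ (C * (1 + ‖x‖) ^ k) * (D * (1 + ‖x‖) ^ l) :=
        mul_le_mul (hf x) (hg x) (abs_nonneg _) (by positivity)
    _ = _ := by ring

lemma PB.add {n : ℕ} {f g : (Fin n → ℝ) → ℝ} (hf : PB f) (hg : PB g) :
    PB (fun x => f x + g x) := by
  obtain ⟨hfc, C, k, hC, hf⟩ := hf
  obtain ⟨hgc, D, l, hD, hg⟩ := hg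
  refine ⟨hfc.add hgc, C + D, k + l, add_nonneg hC hD, fun x => ?_⟩
  have h1 : (1:ℝ) ≤ 1 + ‖x‖ := by linarith [norm_nonneg x]
  have hk : (1 + ‖x‖) ^ k ≤ (1 + ‖x‖) ^ (k + l) := pow_le_pow_right₀ h1 (by omega)
  have hl : (1 + ‖x‖) ^ l ≤ (1 + ‖x‖) ^ (k + l) := pow_le_pow_right₀ h1 (by omega)
  calc _ ≤ |f x| + |g x| := abs_add_le _ _
    _ ≤ C * (1 + ‖x‖) ^ (k + l) + D * (1 + ‖x‖) ^ (k + l) :=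
        add_le_add ((hf x).trans (mul_le_mul_of_nonneg_left hk hC))
          ((hg x).trans (mul_le_mul_of_nonneg_left hl hD))
    _ = _ := by ring

lemma PB.sum {n : ℕ} {ι : Type*} (s : Finset ι) {f : ι → (Fin n → ℝ) → ℝ}
    (hf : ∀ i ∈ s, PB (f i)) : PB (fun x => ∑ i ∈ s, f i x) := by
  classical
  induction s using Finset.induction_on with
  | empty => simpa using PB.const 0
  | insert a s ha ih =>
    simp only [Finset.sum_insert ha]
    exact (hf a (by simp)).add (ih fun i hi => hf i (by simp [hi]))

lemma PB.pow {n : ℕ} {f : (Fin n → ℝ) → ℝ} (hf : PB f) (k : ℕ) : PB (fun x => f x ^ k) := by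
  induction k with
  | zero => simpa using PB.const 1
  | succ k ih => simpa [pow_succ] using ih.mul hf

/-- the quadratic form -/
def qf {n : ℕ} (P : Matrix (Fin n) (Fin n) ℝ) (x : Fin n → ℝ) : ℝ := x ⬝ᵥ P.mulVec x

lemma PB.mulVec {n : ℕ} (P : Matrix (Fin n) (Fin n) ℝ) (i : Fin n) :
    PB (fun x => P.mulVec x i) := by
  simp only [Matrix.mulVec, dotProduct]
  exact PB.sum _ fun j _ => (PB.const _).mul (PB.coord j)

lemma PB.qf {n : ℕ} (P : Matrix (Fin n) (Fin n) ℝ) : PB (qf P) := by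
  unfold _root_.qf
  simp only [dotProduct]
  exact PB.sum _ fun i _ => (PB.coord i).mul (PB.mulVec P i)

lemma qf_lower {n : ℕ} {P : Matrix (Fin n) (Fin n) ℝ} (hP : P.PosDef) :
    ∃ c : ℝ, 0 < c ∧ ∀ x, c * ‖x‖ ^ 2 ≤ qf P x := by
  have hpos : ∀ x : Fin n → ℝ, x ≠ 0 → 0 < qf P x := fun x hx => by
    simpa [qf] using hP.dotProduct_mulVec_pos hx
  have hsm : ∀ (a : ℝ) (x : Fin n → ℝ), qf P (a • x) = a ^ 2 * qf P x := fun a x => by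
    simp [qf, Matrix.mulVec_smul]; ring
  rcases (Metric.sphere (0 : Fin n → ℝ) 1).eq_empty_or_nonempty with he | hne
  · refine ⟨1, one_pos, fun x => ?_⟩
    have : x = 0 := by
      by_contra hx
      have : (‖x‖⁻¹ • x) ∈ Metric.sphere (0 : Fin n → ℝ) 1 := by
        simp [norm_smul, hx]
      simp [he] at this
    simp [this, qf]
  · obtain ⟨y, hy, hmin⟩ := (isCompact_sphere (0 : Fin n → ℝ) 1).exists_isMinOn hne
      (PB.qf P).1.continuousOn
    have hy0 : y ≠ 0 := by rintro rfl; simp at hy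
    refine ⟨qf P y, hpos y hy0, fun x => ?_⟩
    by_cases hx : x = 0
    · simp [hx, qf]
    have h1 : (‖x‖⁻¹ • x) ∈ Metric.sphere (0 : Fin n → ℝ) 1 := by
      simp [norm_smul, hx]
    have h2 : qf P y ≤ qf P (‖x‖⁻¹ • x) := hmin h1
    rw [hsm] at h2
    have hx' : 0 < ‖x‖ := norm_pos_iff.mpr hx
    calc qf P y * ‖x‖ ^ 2 ≤ ((‖x‖⁻¹) ^ 2 * qf P x) * ‖x‖ ^ 2 := by gcongr
      _ = qf P x := by field_simp

lemma integrable_exp_norm_sq {n : ℕ} {c : ℝ} (hc : 0 < c) :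
    Integrable (fun x : Fin n → ℝ => Real.exp (-c * ‖x‖ ^ 2)) := by
  have hd : 0 < c / (n + 1) := by positivity
  have h1 : Integrable (fun x : Fin n → ℝ => ∏ i, Real.exp (-(c / (n + 1)) * x i ^ 2)) :=
    Integrable.fintype_prod (f := fun (_ : Fin n) (y : ℝ) => Real.exp (-(c / (n + 1)) * y ^ 2))
      (fun i => integrable_exp_neg_mul_sq hd)
  refine h1.mono' (by fun_prop) (ae_of_all _ fun x => ?_)
  rw [Real.norm_eq_abs, abs_of_pos (Real.exp_pos _), ← Real.exp_sum, Real.exp_le_exp,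
    ← Finset.mul_sum]
  have : ∑ i, x i ^ 2 ≤ n * ‖x‖ ^ 2 := by
    calc ∑ i, x i ^ 2 ≤ ∑ _i : Fin n, ‖x‖ ^ 2 := by
          refine Finset.sum_le_sum fun i _ => ?_
          rw [← sq_abs]
          exact pow_le_pow_left₀ (abs_nonneg _) (norm_le_pi_norm x i) 2
      _ = _ := by simp
  have h2 : c / (n + 1) * ∑ i, x i ^ 2 ≤ c * ‖x‖ ^ 2 := by
    calc c / (n + 1) * ∑ i, x i ^ 2 ≤ c / (n + 1) * (n * ‖x‖ ^ 2) := by gcongr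
      _ = c * ‖x‖ ^ 2 * (n / (n + 1)) := by ring
      _ ≤ c * ‖x‖ ^ 2 * 1 := by
        gcongr
        rw [div_le_one (by positivity)]; linarith
      _ = _ := by ring
  linarith

lemma poly_exp_bound (k : ℕ) {c : ℝ} (hc : 0 < c) :
    ∃ D : ℝ, ∀ r : ℝ, 0 ≤ r → (1 + r) ^ k * Real.exp (-c * r ^ 2) ≤ D := by
  refine ⟨k.factorial * Real.exp (1 + 1 / (4 * c)), fun r hr => ?_⟩
  have h1 : (1 + r) ^ k ≤ k.factorial * Real.exp (1 + r) := by
    have := Real.pow_div_factorial_le_exp (1 + r) (by linarith) k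
    rwa [div_le_iff₀ (by positivity), mul_comm] at this
  calc _ ≤ (k.factorial * Real.exp (1 + r)) * Real.exp (-c * r ^ 2) := by gcongr
    _ = k.factorial * Real.exp (1 + r + -c * r ^ 2) := by rw [mul_assoc, ← Real.exp_add]
    _ ≤ _ := by
      refine mul_le_mul_of_nonneg_left (Real.exp_le_exp.mpr ?_) (by positivity)
      have : 1 / (4 * c) - r + c * r ^ 2 = c * (r - 1 / (2 * c)) ^ 2 := by field_simp; ring
      nlinarith [mul_nonneg hc.le (sq_nonneg (r - 1 / (2 * c)))]

/-- unnormalised gaussian -/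
def gau {n : ℕ} (P : Matrix (Fin n) (Fin n) ℝ) (x : Fin n → ℝ) : ℝ := Real.exp (-(1 / 2) * qf P x)

lemma gau_pos {n : ℕ} (P : Matrix (Fin n) (Fin n) ℝ) (x : Fin n → ℝ) : 0 < gau P x :=
  Real.exp_pos _

lemma gau_cont {n : ℕ} (P : Matrix (Fin n) (Fin n) ℝ) : Continuous (gau P) := by
  have := (PB.qf P).1
  unfold gau
  fun_prop

lemma PB.integrable {n : ℕ} {P : Matrix (Fin n) (Fin n) ℝ} (hP : P.PosDef)
    {f : (Fin n → ℝ) → ℝ} (hf : PB f) : Integrable (fun x => f x * gau P x) := by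
  obtain ⟨hfc, C, k, hC, hf⟩ := hf
  obtain ⟨c, hc, hq⟩ := qf_lower hP
  obtain ⟨D, hD⟩ := poly_exp_bound k (c := c / 4) (by positivity)
  refine ((integrable_exp_norm_sq (n := n) (c := c / 4) (by positivity)).const_mul (C * D)).mono'
    (hfc.mul (gau_cont P)).aestronglyMeasurable (ae_of_all _ fun x => ?_)
  rw [Real.norm_eq_abs, abs_mul, abs_of_pos (gau_pos P x)]
  have hg : gau P x ≤ Real.exp (-(c / 4) * ‖x‖ ^ 2) * Real.exp (-(c / 4) * ‖x‖ ^ 2) := by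
    rw [← Real.exp_add]
    unfold gau
    rw [Real.exp_le_exp]
    linarith [hq x]
  calc |f x| * gau P x ≤ (C * (1 + ‖x‖) ^ k) *
        (Real.exp (-(c / 4) * ‖x‖ ^ 2) * Real.exp (-(c / 4) * ‖x‖ ^ 2)) :=
        mul_le_mul (hf x) hg (gau_pos P x).le (by positivity)
    _ = C * ((1 + ‖x‖) ^ k * Real.exp (-(c / 4) * ‖x‖ ^ 2)) * Real.exp (-(c / 4) * ‖x‖ ^ 2) := by
        ring
    _ ≤ _ := by
        gcongr
        exact hD _ (norm_nonneg _)

lemma gau_integrable {n : ℕ} {P : Matrix (Fin n) (Fin n) ℝ} (hP : P.PosDef) :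
    Integrable (gau P) := by
  simpa using PB.integrable hP (PB.const 1)

lemma gau_int_pos {n : ℕ} {P : Matrix (Fin n) (Fin n) ℝ} (hP : P.PosDef) :
    0 < ∫ x, gau P x := by
  rw [integral_pos_iff_support_of_nonneg (fun x => (gau_pos P x).le) (gau_integrable hP)]
  have : Function.support (gau P) = Set.univ := by
    ext x; simp [(gau_pos P x).ne']
  rw [this]
  exact isOpen_univ.measure_pos _ Set.univ_nonempty

lemma hasDerivAt_quad (a b c : ℝ) : HasDerivAt (fun t : ℝ => a + t * b + t ^ 2 * c) b 0 := by
  have h1 := ((hasDerivAt_id' (0:ℝ)).mul_const b).const_add a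
  have h2 := (hasDerivAt_pow 2 (0:ℝ)).mul_const c
  exact (h1.add h2).congr_deriv (by simp)

/-- Stein's identity. -/
lemma stein {n : ℕ} {P : Matrix (Fin n) (Fin n) ℝ} (hP : P.PosDef) (j : Fin n)
    {f f' : (Fin n → ℝ) → ℝ} (hf : PB f) (hf' : PB f')
    (hd : ∀ x, HasLineDerivAt ℝ f (f' x) x (Pi.single j 1)) :
    ∫ x, f x * P.mulVec x j * gau P x = ∫ x, f' x * gau P x := by
  have hsym : Pᵀ = P := by simpa using hP.isHermitian.eq
  have hg : ∀ x, HasLineDerivAt ℝ (gau P) (-(P.mulVec x j) * gau P x) x (Pi.single j 1) := by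
    intro x
    unfold HasLineDerivAt gau
    have hexp : ∀ t : ℝ, qf P (x + t • Pi.single j 1) =
        qf P x + t * (2 * P.mulVec x j) + t ^ 2 * P j j := by
      intro t
      have h1 : x ⬝ᵥ P.mulVec (Pi.single j 1) = P.mulVec x j := by
        rw [Matrix.dotProduct_mulVec, ← Matrix.mulVec_transpose, hsym]
        simp
      have h2 : (Pi.single j 1 : Fin n → ℝ) ⬝ᵥ P.mulVec x = P.mulVec x j := by simp
      have h3 : (Pi.single j 1 : Fin n → ℝ) ⬝ᵥ P.mulVec (Pi.single j 1) = P j j := by simp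
      unfold qf
      rw [Matrix.mulVec_add, Matrix.mulVec_smul, add_dotProduct, dotProduct_add, dotProduct_add,
        smul_dotProduct, smul_dotProduct, dotProduct_smul, dotProduct_smul, h1, h2, h3]
      simp only [smul_eq_mul]; ring
    simp only [hexp]
    have h := (((hasDerivAt_quad (qf P x) (2 * P.mulVec x j) (P j j)).const_mul (-(1 / 2)))).exp
    refine h.congr_deriv ?_
    simp; ring
  have key := integral_bilinear_hasLineDerivAt_right_eq_neg_left_of_integrable
    (μ := (volume : Measure (Fin n → ℝ))) (B := ContinuousLinearMap.mul ℝ ℝ)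
    (f := f) (f' := f') (g := gau P) (g' := fun x => -(P.mulVec x j) * gau P x)
    (v := Pi.single j 1) (by simpa using hf'.integrable hP)
    (by
      have := ((hf.mul (PB.mulVec P j)).integrable hP).neg
      refine this.congr (ae_of_all _ fun x => ?_)
      simp; ring)
    (by simpa using hf.integrable hP) (fun x _ => hd x) (fun x _ => hg x)
  simp only [ContinuousLinearMap.mul_apply'] at key
  have e : ∀ x, f x * (-(P.mulVec x j) * gau P x) = -(f x * P.mulVec x j * gau P x) := by
    intro x; ring
  simp only [e, integral_neg] at key
  linarith

/-- gaussian expectation -/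
def ev {n : ℕ} (P : Matrix (Fin n) (Fin n) ℝ) (f : (Fin n → ℝ) → ℝ) : ℝ :=
  (∫ x, f x * gau P x) / ∫ x, gau P x

lemma ev_sum {n : ℕ} {P : Matrix (Fin n) (Fin n) ℝ} (hP : P.PosDef) {ι : Type*} (s : Finset ι)
    {f : ι → (Fin n → ℝ) → ℝ} (hf : ∀ i ∈ s, PB (f i)) :
    ev P (fun x => ∑ i ∈ s, f i x) = ∑ i ∈ s, ev P (f i) := by
  unfold ev
  simp only [Finset.sum_mul]
  rw [integral_finsetSum _ (fun i hi => (hf i hi).integrable hP), Finset.sum_div]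

lemma ev_smul {n : ℕ} (P : Matrix (Fin n) (Fin n) ℝ) (c : ℝ) (f : (Fin n → ℝ) → ℝ) :
    ev P (fun x => c * f x) = c * ev P f := by
  unfold ev
  simp only [mul_assoc, integral_const_mul]
  ring

lemma ev_add {n : ℕ} {P : Matrix (Fin n) (Fin n) ℝ} (hP : P.PosDef)
    {f g : (Fin n → ℝ) → ℝ} (hf : PB f) (hg : PB g) :
    ev P (fun x => f x + g x) = ev P f + ev P g := by
  unfold ev
  simp only [add_mul]
  rw [integral_add (hf.integrable hP) (hg.integrable hP)]
  ring

lemma ev_const {n : ℕ} {P : Matrix (Fin n) (Fin n) ℝ} (hP : P.PosDef) (c : ℝ) :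
    ev P (fun _ => c) = c := by
  unfold ev
  rw [integral_const_mul, mul_div_assoc, div_self (gau_int_pos hP).ne', mul_one]

lemma ev_stein {n : ℕ} {P : Matrix (Fin n) (Fin n) ℝ} (hP : P.PosDef) (j : Fin n)
    {f f' : (Fin n → ℝ) → ℝ} (hf : PB f) (hf' : PB f')
    (hd : ∀ x, HasLineDerivAt ℝ f (f' x) x (Pi.single j 1)) :
    ev P (fun x => f x * P.mulVec x j) = ev P f' := by
  unfold ev
  rw [stein hP j hf hf' hd]

lemma coord_lineDeriv {n : ℕ} (i j : Fin n) (x : Fin n → ℝ) :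
    HasDerivAt (fun t : ℝ => (x + t • (Pi.single j 1 : Fin n → ℝ)) i) (if i = j then 1 else 0) 0 := by
  have h := ((hasDerivAt_id' (0:ℝ)).mul_const (if i = j then (1:ℝ) else 0)).const_add (x i)
  simp only [Pi.add_apply, Pi.smul_apply, Pi.single_apply, smul_eq_mul]
  exact h.congr_deriv (by simp)

lemma ev_two_aux {n : ℕ} {P : Matrix (Fin n) (Fin n) ℝ} (hP : P.PosDef) (i j : Fin n) :
    ev P (fun x => x i * P.mulVec x j) = if i = j then 1 else 0 := by
  rw [ev_stein hP j (PB.coord i) (PB.const (if i = j then 1 else 0))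
    (fun x => coord_lineDeriv i j x), ev_const hP]

lemma ev_two {n : ℕ} {G : Matrix (Fin n) (Fin n) ℝ} (hG : G.PosDef) (i k : Fin n) :
    ev G⁻¹ (fun x => x i * x k) = G i k := by
  have hP := hG.inv
  have hdet : IsUnit G.det := (Matrix.isUnit_iff_isUnit_det _).mp hG.isUnit
  have e : (fun x : Fin n → ℝ => x i * x k) =
      fun x => ∑ j, G k j * (x i * (G⁻¹).mulVec x j) := by
    funext x
    have : x k = G.mulVec ((G⁻¹).mulVec x) k := by
      rw [Matrix.mulVec_mulVec, Matrix.mul_nonsing_inv _ hdet, Matrix.one_mulVec]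
    conv_lhs => rw [this, Matrix.mulVec, dotProduct, Finset.mul_sum]
    refine Finset.sum_congr rfl fun j _ => by ring
  rw [e, ev_sum hP _ (fun j _ => (PB.const _).mul ((PB.coord i).mul (PB.mulVec _ j)))]
  simp only [ev_smul, ev_two_aux hP]
  have hs : G k i = G i k := by
    have := congrFun (congrFun hG.isHermitian.eq k) i
    simpa using this.symm
  simp [hs]

lemma ev_four {n : ℕ} {G : Matrix (Fin n) (Fin n) ℝ} (hG : G.PosDef) (i k j : Fin n) :
    ev G⁻¹ (fun x => (x i * x k ^ 2) * (G⁻¹).mulVec x j) =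
      (if i = j then 1 else 0) * G k k + 2 * (if k = j then 1 else 0) * G i k := by
  have hP := hG.inv
  have h1 : PB (fun x : Fin n → ℝ => x k * x k) := (PB.coord k).mul (PB.coord k)
  have h2 : PB (fun x : Fin n → ℝ => x i * x k) := (PB.coord i).mul (PB.coord k)
  rw [ev_stein hP j (f' := fun x => (if i = j then 1 else 0) * (x k * x k) +
      (2 * (if k = j then 1 else 0)) * (x i * x k)) ((PB.coord i).mul ((PB.coord k).pow 2))
      (((PB.const _).mul h1).add ((PB.const _).mul h2)),
    ev_add hP ((PB.const _).mul h1) ((PB.const _).mul h2), ev_smul, ev_smul, ev_two hG, ev_two hG]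
  intro x
  have := (coord_lineDeriv i j x).mul ((coord_lineDeriv k j x).pow 2)
  refine HasDerivAt.congr_deriv this ?_
  simp; ring

/-- first variation of U -/
def dU {n : ℕ} (v A : Matrix (Fin n) (Fin n) ℝ) (x : Fin n → ℝ) : ℝ :=
  (1 / 2) * ∑ i, ∑ k, v i k * (x i * x k ^ 2 * A.mulVec x i)

lemma PB.dU {n : ℕ} (v A : Matrix (Fin n) (Fin n) ℝ) : PB (dU v A) :=
  (PB.const _).mul (PB.sum _ fun i _ => PB.sum _ fun k _ => (PB.const _).mul
    (((PB.coord i).mul ((PB.coord k).pow 2)).mul (PB.mulVec A i)))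

lemma dU_neg {n : ℕ} (v A : Matrix (Fin n) (Fin n) ℝ) (x : Fin n → ℝ) :
    dU v (-A) x = - dU v A x := by
  unfold dU
  simp [Matrix.neg_mulVec]

lemma ev_dU {n : ℕ} {G : Matrix (Fin n) (Fin n) ℝ} (hG : G.PosDef)
    (v H : Matrix (Fin n) (Fin n) ℝ) :
    2 * ev G⁻¹ (dU v ((1 / 2 : ℝ) • (H * G⁻¹))) =
      (1 / 2) * ∑ i, (∑ k, v i k * G k k) * H i i + ∑ i, ∑ j, v i j * G i j * H i j := by
  have hP := hG.inv
  have e : dU v ((1 / 2 : ℝ) • (H * G⁻¹)) = fun x => (1 / 4) * ∑ i, ∑ k, ∑ j, (v i k * H i j) *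
      ((x i * x k ^ 2) * (G⁻¹).mulVec x j) := by
    funext x
    unfold dU
    have : ∀ i, (((1 / 2 : ℝ) • (H * G⁻¹)).mulVec x) i =
        (1 / 2) * ∑ j, H i j * (G⁻¹).mulVec x j := by
      intro i
      rw [Matrix.smul_mulVec, ← Matrix.mulVec_mulVec, Pi.smul_apply, smul_eq_mul]
      rfl
    simp only [this, Finset.mul_sum]
    refine Finset.sum_congr rfl fun i _ => Finset.sum_congr rfl fun k _ =>
      Finset.sum_congr rfl fun j _ => by ring
  have hPB : ∀ i k j : Fin n, PB (fun x : Fin n → ℝ => (v i k * H i j) *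
      ((x i * x k ^ 2) * (G⁻¹).mulVec x j)) := fun i k j =>
    (PB.const _).mul (((PB.coord i).mul ((PB.coord k).pow 2)).mul (PB.mulVec _ j))
  rw [e, ev_smul, ev_sum hP _ fun i _ => PB.sum _ fun k _ => PB.sum _ fun j _ => hPB i k j]
  have : ∀ i, ev G⁻¹ (fun x => ∑ k, ∑ j, (v i k * H i j) *
      ((x i * x k ^ 2) * (G⁻¹).mulVec x j)) =
      (∑ k, v i k * G k k) * H i i + 2 * ∑ k, v i k * G i k * H i k := by
    intro i
    rw [ev_sum hP _ fun k _ => PB.sum _ fun j _ => hPB i k j]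
    have : ∀ k, ev G⁻¹ (fun x => ∑ j, (v i k * H i j) *
        ((x i * x k ^ 2) * (G⁻¹).mulVec x j)) =
        v i k * G k k * H i i + 2 * (v i k * G i k * H i k) := by
      intro k
      rw [ev_sum hP _ fun j _ => hPB i k j]
      simp only [ev_smul, ev_four hG, mul_add, Finset.sum_add_distrib]
      simp
      ring_nf
    simp only [this, Finset.sum_add_distrib, Finset.sum_mul, Finset.mul_sum]
  simp only [this, Finset.sum_add_distrib, ← Finset.mul_sum]
  ring

lemma quart_lower {n : ℕ} {U : (Fin n → ℝ) → ℝ} (hU : SuperQuadratic U)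
    (hom : ∀ (a : ℝ) x, U (a • x) = a ^ 4 * U x) :
    ∃ c : ℝ, 0 < c ∧ ∀ x, c * ‖x‖ ^ 4 ≤ U x := by
  have h := (hU.2 1 one_pos).eventually_ge_atTop 0
  rw [← Metric.cobounded_eq_cocompact] at h
  obtain ⟨R, -, hR⟩ := (hasBasis_cobounded_norm (E := Fin n → ℝ)).eventually_iff.mp h
  set r := max R 1 with hr
  have hr1 : 1 ≤ r := le_max_right _ _
  have hr0 : 0 < r := by linarith
  refine ⟨1 / r ^ 2, by positivity, fun x => ?_⟩
  by_cases hx : x = 0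
  · have := hom 0 0
    rw [smul_zero, zero_pow (by norm_num), zero_mul] at this
    rw [hx, this, norm_zero, zero_pow (by norm_num), mul_zero]
  have hx' : 0 < ‖x‖ := norm_pos_iff.mpr hx
  have hny : ‖(r / ‖x‖) • x‖ = r := by
    rw [norm_smul, Real.norm_eq_abs, abs_of_pos (by positivity)]; field_simp
  have := hR (x := (r / ‖x‖) • x) (by simp only [Set.mem_ofPred_eq, hny]; exact le_max_left _ _)
  rw [hny, hom] at this
  have h2 : r ^ 2 ≤ (r / ‖x‖) ^ 4 * U x := by linarith
  rw [div_pow, div_mul_eq_mul_div, le_div_iff₀ (by positivity)] at h2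
  rw [div_mul_eq_mul_div, one_mul, div_le_iff₀ (by positivity)]
  have h3 : r ^ 2 * ‖x‖ ^ 4 ≤ r ^ 2 * (U x * r ^ 2) := by
    calc _ ≤ r ^ 4 * U x := h2
      _ = _ := by ring
  exact le_of_mul_le_mul_left h3 (by positivity)

/-- the quartic interaction -/
def quart {n : ℕ} (v : Matrix (Fin n) (Fin n) ℝ) (x : Fin n → ℝ) : ℝ :=
  (1 / 8) * ∑ i, ∑ j, v i j * (x i) ^ 2 * (x j) ^ 2

lemma quart_hom {n : ℕ} (v : Matrix (Fin n) (Fin n) ℝ) (a : ℝ) (x : Fin n → ℝ) :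
    quart v (a • x) = a ^ 4 * quart v x := by
  unfold quart
  simp only [Finset.mul_sum, Pi.smul_apply, smul_eq_mul]
  refine Finset.sum_congr rfl fun i _ => Finset.sum_congr rfl fun j _ => by ring

lemma PB.quart {n : ℕ} (v : Matrix (Fin n) (Fin n) ℝ) : PB (quart v) :=
  (PB.const _).mul (PB.sum _ fun i _ => PB.sum _ fun k _ => ((PB.const _).mul
    ((PB.coord i).pow 2)).mul ((PB.coord k).pow 2))

lemma abs_coord {n : ℕ} (x : Fin n → ℝ) (i : Fin n) : |x i| ≤ ‖x‖ := norm_le_pi_norm x i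

lemma mulVec_bound {n : ℕ} (A : Matrix (Fin n) (Fin n) ℝ) :
    ∃ a : ℝ, 0 ≤ a ∧ ∀ x : Fin n → ℝ, ‖A.mulVec x‖ ≤ a * ‖x‖ := by
  let L : (Fin n → ℝ) →L[ℝ] (Fin n → ℝ) := LinearMap.toContinuousLinearMap (Matrix.mulVecLin A)
  exact ⟨‖L‖, norm_nonneg _, fun x => L.le_opNorm x⟩

lemma quart_bound {n : ℕ} (v : Matrix (Fin n) (Fin n) ℝ) :
    ∃ K : ℝ, 0 ≤ K ∧ ∀ x, |quart v x| ≤ K * ‖x‖ ^ 4 := by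
  refine ⟨(1 / 8) * ∑ i, ∑ j, |v i j|, by positivity, fun x => ?_⟩
  unfold quart
  rw [abs_mul, abs_of_pos (by norm_num : (0:ℝ) < 1 / 8), mul_assoc]
  gcongr
  rw [Finset.sum_mul]
  refine (Finset.abs_sum_le_sum_abs _ _).trans (Finset.sum_le_sum fun i _ => ?_)
  rw [Finset.sum_mul]
  refine (Finset.abs_sum_le_sum_abs _ _).trans (Finset.sum_le_sum fun j _ => ?_)
  rw [abs_mul, abs_mul, mul_assoc, abs_pow, abs_pow]
  gcongr
  calc |x i| ^ 2 * |x j| ^ 2 ≤ ‖x‖ ^ 2 * ‖x‖ ^ 2 := by gcongr <;> exact abs_coord x _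
    _ = _ := by ring

lemma dU_bound {n : ℕ} (v A : Matrix (Fin n) (Fin n) ℝ) :
    ∃ K : ℝ, 0 ≤ K ∧ ∀ x, |dU v A x| ≤ K * ‖x‖ ^ 4 := by
  obtain ⟨a, ha, hA⟩ := mulVec_bound A
  refine ⟨(1 / 2) * ∑ i, ∑ j, |v i j| * a, by positivity, fun x => ?_⟩
  unfold dU
  rw [abs_mul, abs_of_pos (by norm_num : (0:ℝ) < 1 / 2), mul_assoc]
  gcongr
  rw [Finset.sum_mul]
  refine (Finset.abs_sum_le_sum_abs _ _).trans (Finset.sum_le_sum fun i _ => ?_)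
  rw [Finset.sum_mul]
  refine (Finset.abs_sum_le_sum_abs _ _).trans (Finset.sum_le_sum fun j _ => ?_)
  rw [abs_mul, abs_mul, abs_mul, abs_pow, mul_assoc |v i j|]
  refine mul_le_mul_of_nonneg_left ?_ (abs_nonneg _)
  calc |x i| * |x j| ^ 2 * |A.mulVec x i| ≤ ‖x‖ * ‖x‖ ^ 2 * (a * ‖x‖) := by
        gcongr
        · exact abs_coord x _
        · exact abs_coord x _
        · exact (abs_coord _ _).trans (hA x)
    _ = _ := by ring

lemma quart_expand {n : ℕ} {v : Matrix (Fin n) (Fin n) ℝ} (hv : v.IsSymm)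
    (A : Matrix (Fin n) (Fin n) ℝ) :
    ∃ K : ℝ, 0 ≤ K ∧ ∀ (t : ℝ) x, 0 ≤ t → t ≤ 1 →
      quart v (x + t • A.mulVec x) ≤ quart v x + t * dU v A x + t ^ 2 * (K * ‖x‖ ^ 4) := by
  obtain ⟨a, ha, hA⟩ := mulVec_bound A
  refine ⟨(1 / 8) * ∑ i, ∑ j, |v i j| * (2 * a ^ 2 + (2 * a + a ^ 2) ^ 2),
    by positivity, fun t x ht ht1 => ?_⟩
  set y := A.mulVec x with hy
  have hyb : ∀ i, |y i| ≤ a * ‖x‖ := fun i => (abs_coord y i).trans (hA x)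
  have hxb : ∀ i, |x i| ≤ ‖x‖ := abs_coord x
  have hd : dU v A x = (1 / 8) * ∑ i, ∑ j, v i j * (2 * x i * y i * x j ^ 2 + 2 * x i ^ 2 * x j * y j) := by
    have h1 : ∑ i, ∑ j, v i j * (2 * x i ^ 2 * x j * y j) =
        ∑ i, ∑ j, v i j * (2 * x i * y i * x j ^ 2) := by
      rw [Finset.sum_comm]
      refine Finset.sum_congr rfl fun i _ => Finset.sum_congr rfl fun j _ => ?_
      rw [hv.apply i j]; ring
    simp only [mul_add, Finset.sum_add_distrib]
    rw [h1, ← mul_add, ← two_mul]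
    unfold dU
    simp only [Finset.mul_sum]
    refine Finset.sum_congr rfl fun i _ => Finset.sum_congr rfl fun j _ => ?_
    ring
  have hE : quart v (x + t • y) = quart v x + t * dU v A x + t ^ 2 * ((1 / 8) * ∑ i, ∑ j, v i j *
      (y i ^ 2 * x j ^ 2 + x i ^ 2 * y j ^ 2 +
        (2 * x i * y i + t * y i ^ 2) * (2 * x j * y j + t * y j ^ 2))) := by
    rw [hd]
    unfold quart
    simp only [Finset.mul_sum, ← Finset.sum_add_distrib, Pi.add_apply, Pi.smul_apply, smul_eq_mul]
    refine Finset.sum_congr rfl fun i _ => Finset.sum_congr rfl fun j _ => ?_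
    ring
  rw [hE]
  refine add_le_add le_rfl (mul_le_mul_of_nonneg_left ?_ (sq_nonneg t))
  rw [mul_assoc]
  refine mul_le_mul_of_nonneg_left ?_ (by norm_num)
  rw [Finset.sum_mul]
  refine Finset.sum_le_sum fun i _ => ?_
  rw [Finset.sum_mul]
  refine Finset.sum_le_sum fun j _ => ?_
  refine (le_abs_self _).trans ?_
  rw [abs_mul, mul_assoc |v i j|]
  refine mul_le_mul_of_nonneg_left ?_ (abs_nonneg _)
  have hb : ∀ i, |2 * x i * y i + t * y i ^ 2| ≤ (2 * a + a ^ 2) * ‖x‖ ^ 2 := by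
    intro i
    calc |2 * x i * y i + t * y i ^ 2| ≤ |2 * x i * y i| + |t * y i ^ 2| := abs_add_le _ _
      _ = 2 * |x i| * |y i| + t * |y i| ^ 2 := by
        rw [abs_mul, abs_mul, abs_mul, abs_pow, abs_of_nonneg ht]; norm_num
      _ ≤ 2 * ‖x‖ * (a * ‖x‖) + 1 * (a * ‖x‖) ^ 2 := by
        gcongr
        · exact hxb i
        · exact hyb i
        · exact hyb i
      _ = _ := by ring
  calc |y i ^ 2 * x j ^ 2 + x i ^ 2 * y j ^ 2 +
        (2 * x i * y i + t * y i ^ 2) * (2 * x j * y j + t * y j ^ 2)| ≤ |y i ^ 2 * x j ^ 2| + |x i ^ 2 * y j ^ 2| +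
        |(2 * x i * y i + t * y i ^ 2) * (2 * x j * y j + t * y j ^ 2)| :=
        abs_add_three _ _ _
    _ = |y i| ^ 2 * |x j| ^ 2 + |x i| ^ 2 * |y j| ^ 2 +
        |(2 * x i * y i + t * y i ^ 2)| * |(2 * x j * y j + t * y j ^ 2)| := by
        simp only [abs_mul, abs_pow]
    _ ≤ (a * ‖x‖) ^ 2 * ‖x‖ ^ 2 + ‖x‖ ^ 2 * (a * ‖x‖) ^ 2 +
        ((2 * a + a ^ 2) * ‖x‖ ^ 2) * ((2 * a + a ^ 2) * ‖x‖ ^ 2) := by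
        gcongr
        · exact hyb i
        · exact hxb j
        · exact hxb i
        · exact hyb j
        · exact hb i
        · exact hb j
    _ = _ := by ring

lemma lin3 {n : ℕ} {f g h : (Fin n → ℝ) → ℝ} (hf : Integrable f) (hg : Integrable g)
    (hh : Integrable h) (a b c : ℝ) :
    Integrable (fun x => a * f x + b * g x + c * h x) ∧
    ∫ x, (a * f x + b * g x + c * h x) = a * (∫ x, f x) + b * (∫ x, g x) + c * ∫ x, h x := by
  have h1 : Integrable (fun x => a * f x) := hf.const_mul a
  have h2 : Integrable (fun x => b * g x) := hg.const_mul b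
  have h3 : Integrable (fun x => c * h x) := hh.const_mul c
  have h12 : Integrable (fun x => a * f x + b * g x) := h1.add h2
  refine ⟨h12.add h3, ?_⟩
  rw [integral_add h12 h3, integral_add h1 h2, integral_const_mul, integral_const_mul,
    integral_const_mul]

lemma good_integrable {n : ℕ} {ρ : (Fin n → ℝ) → ℝ} (h : IsGoodDensity ρ) : Integrable ρ := by
  by_contra hc
  have := h.2.2.1
  rw [integral_undef hc] at this
  exact zero_ne_one this

lemma qf_eq {n : ℕ} (P : Matrix (Fin n) (Fin n) ℝ) (x : Fin n → ℝ) :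
    qf P x = ∑ i, ∑ j, P i j * (x i * x j) := by
  unfold qf
  simp only [dotProduct, Matrix.mulVec, Finset.mul_sum]
  refine Finset.sum_congr rfl fun i _ => Finset.sum_congr rfl fun j _ => by ring

lemma qf_rho {n : ℕ} (P : Matrix (Fin n) (Fin n) ℝ) {ρ : (Fin n → ℝ) → ℝ}
    (h : ∀ i j : Fin n, Integrable fun x => x i * x j * ρ x) :
    Integrable (fun x => qf P x * ρ x) ∧
      ∫ x, qf P x * ρ x = ∑ i, ∑ j, P i j * momMatrix ρ i j := by
  have e : (fun x => qf P x * ρ x) = fun x => ∑ i, ∑ j, P i j * (x i * x j * ρ x) := by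
    funext x
    simp only [qf_eq, Finset.sum_mul, mul_assoc]
  have h1 : ∀ i j, Integrable (fun x => P i j * (x i * x j * ρ x)) :=
    fun i j => (h i j).const_mul _
  have h2 : ∀ i, Integrable (fun x => ∑ j, P i j * (x i * x j * ρ x)) :=
    fun i => integrable_finsetSum _ fun j _ => h1 i j
  rw [e]
  refine ⟨integrable_finsetSum _ fun i _ => h2 i, ?_⟩
  rw [integral_finsetSum _ fun i _ => h2 i]
  refine Finset.sum_congr rfl fun i _ => ?_
  rw [integral_finsetSum _ fun j _ => h1 i j]
  refine Finset.sum_congr rfl fun j _ => ?_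
  rw [integral_const_mul]
  rfl

lemma exp_neg_quad {y : ℝ} (hy : 0 ≤ y) : Real.exp (-y) ≤ 1 - y + y ^ 2 / 2 := by
  have h := Real.quadratic_le_exp_of_nonneg hy
  rw [Real.exp_neg]
  have hp : 0 < Real.exp y := Real.exp_pos y
  rw [inv_le_iff_one_le_mul₀ hp]
  have : 0 ≤ 1 - y + y ^ 2 / 2 := by nlinarith [sq_nonneg (y - 1)]
  calc (1:ℝ) ≤ (1 - y + y ^ 2 / 2) * (1 + y + y ^ 2 / 2) := by nlinarith [sq_nonneg (y ^ 2)]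
    _ ≤ _ := by gcongr

lemma gibbs_pt {r g : ℝ} (hr : 0 ≤ r) (hg : 0 < g) :
    r * Real.log g + r - g ≤ r * Real.log r := by
  rcases hr.eq_or_lt with h | h
  · subst h; simp; exact hg.le
  · have := Real.log_le_sub_one_of_pos (div_pos hg h)
    rw [Real.log_div hg.ne' h.ne'] at this
    have h2 := mul_le_mul_of_nonneg_left this h.le
    have h3 : r * (g / r - 1) = g - r := by field_simp
    nlinarith

lemma ent_bound {n : ℕ} {P : Matrix (Fin n) (Fin n) ℝ} (hP : P.PosDef)
    {ρ : (Fin n → ℝ) → ℝ} (h : IsGoodDensity ρ) {q : (Fin n → ℝ) → ℝ} (hq : PB q)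
    (hq0 : ∀ x, 0 ≤ q x) (hqi : Integrable fun x => q x * ρ x) {l : ℝ} (hl : 0 ≤ l) :
    entropy ρ ≤ Real.log (∫ x, gau P x) + (1 / 2) * ∑ i, ∑ j, P i j * momMatrix ρ i j
      + l * ((∫ x, q x * ρ x) - ev P q) + l ^ 2 / 2 * ev P (fun x => q x ^ 2) := by
  set Z := ∫ x, gau P x with hZ
  have hZ0 : 0 < Z := gau_int_pos hP
  have hρi := good_integrable h
  obtain ⟨hQi, hQ⟩ := qf_rho P h.2.2.2.1
  have hg0 : ∀ x, 0 < gau P x / Z * Real.exp (-(l * q x)) := fun x =>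
    mul_pos (div_pos (gau_pos P x) hZ0) (Real.exp_pos _)
  have hlog : ∀ x, Real.log (gau P x / Z * Real.exp (-(l * q x))) =
      -(1 / 2) * qf P x - Real.log Z - l * q x := by
    intro x
    rw [Real.log_mul (div_pos (gau_pos P x) hZ0).ne' (Real.exp_pos _).ne', Real.log_exp,
      Real.log_div (gau_pos P x).ne' hZ0.ne', gau, Real.log_exp]
    ring
  have hqc := hq.1
  have hgc := gau_cont P
  have hgi : Integrable (fun x => gau P x / Z * Real.exp (-(l * q x))) := by
    refine ((gau_integrable hP).div_const Z).mono' (by fun_prop) (ae_of_all _ fun x => ?_)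
    rw [Real.norm_eq_abs, abs_of_pos (hg0 x)]
    have : Real.exp (-(l * q x)) ≤ 1 := Real.exp_le_one_iff.mpr
      (by linarith [mul_nonneg hl (hq0 x)])
    exact mul_le_of_le_one_right (div_pos (gau_pos P x) hZ0).le this
  -- upper bound on the integral of g
  have hgint : ∫ x, gau P x / Z * Real.exp (-(l * q x)) ≤
      1 - l * ev P q + l ^ 2 / 2 * ev P (fun x => q x ^ 2) := by
    have hi1 := hq.integrable hP
    have hi2 := (hq.pow 2).integrable hP
    have hi0 := gau_integrable hP
    have hR : ∫ x, (Z⁻¹ * gau P x + (-(l * Z⁻¹)) * (q x * gau P x)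
        + (l ^ 2 / 2 * Z⁻¹) * (q x ^ 2 * gau P x)) =
        1 - l * ev P q + l ^ 2 / 2 * ev P (fun x => q x ^ 2) := by
      rw [(lin3 hi0 hi1 hi2 _ _ _).2]
      unfold ev
      rw [← hZ]
      field_simp
      ring
    rw [← hR]
    refine integral_mono hgi (lin3 hi0 hi1 hi2 _ _ _).1
      fun x => ?_
    have := mul_le_mul_of_nonneg_left (exp_neg_quad (mul_nonneg hl (hq0 x)))
      (div_pos (gau_pos P x) hZ0).le
    refine this.trans (le_of_eq ?_)
    field_simp
    ring
  have hL : ∫ x, ((-(1 / 2)) * (qf P x * ρ x) + (1 - Real.log Z) * ρ x + (-l) * (q x * ρ x)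
      - gau P x / Z * Real.exp (-(l * q x))) =
      -(1 / 2) * (∑ i, ∑ j, P i j * momMatrix ρ i j) + (1 - Real.log Z)
      + (-l) * (∫ x, q x * ρ x) - ∫ x, gau P x / Z * Real.exp (-(l * q x)) := by
    rw [integral_sub (lin3 hQi hρi hqi _ _ _).1 hgi, (lin3 hQi hρi hqi _ _ _).2, hQ, h.2.2.1, mul_one]
  have hmono : ∫ x, ((-(1 / 2)) * (qf P x * ρ x) + (1 - Real.log Z) * ρ x + (-l) * (q x * ρ x)
      - gau P x / Z * Real.exp (-(l * q x))) ≤ ∫ x, ρ x * Real.log (ρ x) := by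
    refine integral_mono ((lin3 hQi hρi hqi _ _ _).1.sub hgi)
      h.2.2.2.2 fun x => ?_
    have := gibbs_pt (h.2.1 x) (hg0 x)
    rw [hlog] at this
    refine le_trans (le_of_eq ?_) this
    ring
  rw [hL] at hmono
  unfold entropy
  linarith

/-- the normalised gaussian is admissible -/
lemma gauss_good {n : ℕ} {G : Matrix (Fin n) (Fin n) ℝ} (hG : G.PosDef) :
    ∃ ρ : (Fin n → ℝ) → ℝ, IsGoodDensity ρ ∧ momMatrix ρ = G ∧
      entropy ρ = Real.log (∫ x, gau G⁻¹ x) + (1 / 2) * ∑ i, ∑ j, G⁻¹ i j * G i j ∧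
      ∀ f, PB f → Integrable (fun x => f x * ρ x) ∧ ∫ x, f x * ρ x = ev G⁻¹ f := by
  have hP := hG.inv
  set P := G⁻¹ with hPdef
  set Z := ∫ x, gau P x with hZ
  have hZ0 : 0 < Z := gau_int_pos hP
  have hf : ∀ f, PB f → Integrable (fun x => f x * (gau P x / Z)) ∧
      ∫ x, f x * (gau P x / Z) = ev P f := by
    intro f hf
    have e : (fun x => f x * (gau P x / Z)) = fun x => (f x * gau P x) / Z := by
      funext x; ring
    rw [e]
    exact ⟨(hf.integrable hP).div_const Z, by rw [integral_div]; rfl⟩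
  have hmomI : ∀ i j : Fin n, Integrable fun x => x i * x j * (gau P x / Z) :=
    fun i j => (hf _ ((PB.coord i).mul (PB.coord j))).1
  have hmom : momMatrix (fun x => gau P x / Z) = G := by
    ext i j
    simp only [momMatrix, Matrix.of_apply]
    rw [(hf _ ((PB.coord i).mul (PB.coord j))).2, hPdef, ev_two hG]
  obtain ⟨hQi, hQ⟩ := qf_rho P hmomI
  rw [hmom] at hQ
  have hone : ∫ x, gau P x / Z = 1 := by
    rw [integral_div, ← hZ, div_self hZ0.ne']
  have hi : Integrable (fun x => gau P x / Z) := (gau_integrable hP).div_const Z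
  have e : (fun x => gau P x / Z * Real.log (gau P x / Z)) =
      fun x => (-(1 / 2)) * (qf P x * (gau P x / Z)) + (-Real.log Z) * (gau P x / Z) := by
    funext x
    rw [Real.log_div (gau_pos P x).ne' hZ0.ne']
    conv_lhs => rw [show Real.log (gau P x) = -(1 / 2) * qf P x by rw [gau, Real.log_exp]]
    ring
  refine ⟨fun x => gau P x / Z, ⟨((gau_cont P).div_const Z).measurable,
    fun x => (div_pos (gau_pos P x) hZ0).le, hone, hmomI, ?_⟩, hmom, ?_, hf⟩
  · rw [e]
    exact (hQi.const_mul _).add (hi.const_mul _)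
  · unfold entropy
    rw [e, integral_add (hQi.const_mul _) (hi.const_mul _), integral_const_mul, integral_const_mul,
      hQ, hone]
    ring

lemma cov {n : ℕ} {T : Matrix (Fin n) (Fin n) ℝ} (hT : T.det ≠ 0) {k : (Fin n → ℝ) → ℝ}
    (hk : Integrable k) :
    Integrable (fun x => |T.det|⁻¹ * k (T⁻¹.mulVec x)) ∧
      ∫ x, |T.det|⁻¹ * k (T⁻¹.mulVec x) = ∫ x, k x := by
  have hu : IsUnit T.det := isUnit_iff_ne_zero.mpr hT
  have hTi : T⁻¹.det ≠ 0 := by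
    rw [Matrix.det_nonsing_inv, Ring.inverse_eq_inv']; exact inv_ne_zero hT
  have hm := Real.map_matrix_volume_pi_eq_smul_volume_pi hTi
  rw [Matrix.det_nonsing_inv, Ring.inverse_eq_inv', inv_inv] at hm
  let e : (Fin n → ℝ) ≃L[ℝ] (Fin n → ℝ) := (Matrix.toLin'OfInv
    (Matrix.mul_nonsing_inv T hu) (Matrix.nonsing_inv_mul T hu)).toContinuousLinearEquiv
  have hemb : MeasurableEmbedding (Matrix.toLin' T⁻¹) := e.toHomeomorph.measurableEmbedding
  have hk2 : Integrable k (Measure.map (Matrix.toLin' T⁻¹) volume) := by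
    rw [hm]; exact hk.smul_measure ENNReal.ofReal_ne_top
  have hi : Integrable (fun x => k (T⁻¹.mulVec x)) := (hemb.integrable_map_iff).mp hk2
  refine ⟨hi.const_mul _, ?_⟩
  have h2 : ∫ x, k (T⁻¹.mulVec x) = |T.det| * ∫ x, k x := by
    have := hemb.integral_map (μ := volume) k
    rw [hm, integral_smul_measure, ENNReal.toReal_ofReal (abs_nonneg _)] at this
    exact this.symm
  rw [integral_const_mul, h2, ← mul_assoc, inv_mul_cancel₀ (abs_pos.mpr hT).ne', one_mul]

lemma push_good {n : ℕ} {T : Matrix (Fin n) (Fin n) ℝ} (hT : T.det ≠ 0) {ρ : (Fin n → ℝ) → ℝ}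
    (h : IsGoodDensity ρ) :
    ∃ ρ' : (Fin n → ℝ) → ℝ, IsGoodDensity ρ' ∧ momMatrix ρ' = T * momMatrix ρ * Tᵀ ∧
      entropy ρ' = entropy ρ + Real.log |T.det| ∧
      ∀ f : (Fin n → ℝ) → ℝ, Integrable (fun x => f (T.mulVec x) * ρ x) →
        Integrable (fun x => f x * ρ' x) ∧
          ∫ x, f x * ρ' x = ∫ x, f (T.mulVec x) * ρ x := by
  have hu : IsUnit T.det := isUnit_iff_ne_zero.mpr hT
  have hd : 0 < |T.det| := abs_pos.mpr hT
  have hinv : ∀ x, T.mulVec (T⁻¹.mulVec x) = x := fun x => by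
    rw [Matrix.mulVec_mulVec, Matrix.mul_nonsing_inv _ hu, Matrix.one_mulVec]
  have hf : ∀ f : (Fin n → ℝ) → ℝ, Integrable (fun x => f (T.mulVec x) * ρ x) →
        Integrable (fun x => f x * (|T.det|⁻¹ * ρ (T⁻¹.mulVec x))) ∧
          ∫ x, f x * (|T.det|⁻¹ * ρ (T⁻¹.mulVec x)) = ∫ x, f (T.mulVec x) * ρ x := by
    intro f hf
    have := cov hT hf
    have e : (fun x => |T.det|⁻¹ * (fun y => f (T.mulVec y) * ρ y) (T⁻¹.mulVec x)) =
        fun x => f x * (|T.det|⁻¹ * ρ (T⁻¹.mulVec x)) := by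
      funext x
      simp only [hinv]; ring
    rwa [e] at this
  have hρi := good_integrable h
  have hmom : ∀ i j, Integrable (fun x => T.mulVec x i * T.mulVec x j * ρ x) ∧
      ∫ x, T.mulVec x i * T.mulVec x j * ρ x = (T * momMatrix ρ * Tᵀ) i j := by
    intro i j
    have e : (fun x => T.mulVec x i * T.mulVec x j * ρ x) =
        fun x => ∑ l, ∑ k, (T i k * T j l) * (x k * x l * ρ x) := by
      funext x
      simp only [Matrix.mulVec, dotProduct, Finset.sum_mul, Finset.mul_sum]
      refine Finset.sum_congr rfl fun k _ => Finset.sum_congr rfl fun l _ => by ring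
    have h1 : ∀ l k, Integrable (fun x => (T i k * T j l) * (x k * x l * ρ x)) :=
      fun l k => (h.2.2.2.1 k l).const_mul _
    have h2 : ∀ l, Integrable (fun x => ∑ k, (T i k * T j l) * (x k * x l * ρ x)) :=
      fun l => integrable_finsetSum _ fun k _ => h1 l k
    rw [e]
    refine ⟨integrable_finsetSum _ fun l _ => h2 l, ?_⟩
    rw [integral_finsetSum _ fun l _ => h2 l]
    simp only [Matrix.mul_apply, Finset.sum_mul, Matrix.transpose_apply]
    refine Finset.sum_congr rfl fun l _ => ?_
    rw [integral_finsetSum _ fun k _ => h1 l k]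
    refine Finset.sum_congr rfl fun k _ => ?_
    rw [integral_const_mul]
    simp only [momMatrix, Matrix.of_apply]
    ring
  have hent : Integrable (fun x => (|T.det|⁻¹ * ρ (T⁻¹.mulVec x)) *
        Real.log (|T.det|⁻¹ * ρ (T⁻¹.mulVec x))) ∧
      ∫ x, (|T.det|⁻¹ * ρ (T⁻¹.mulVec x)) * Real.log (|T.det|⁻¹ * ρ (T⁻¹.mulVec x)) =
      (∫ x, ρ x * Real.log (ρ x)) - Real.log |T.det| := by
    have h1 : Integrable (fun x => Real.log |T.det| * ρ x) := hρi.const_mul _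
    have hc := cov hT (h.2.2.2.2.sub h1)
    have e : (fun x => |T.det|⁻¹ * ((fun y => ρ y * Real.log (ρ y)) -
        (fun y => Real.log |T.det| * ρ y)) (T⁻¹.mulVec x)) =
        (fun x => (|T.det|⁻¹ * ρ (T⁻¹.mulVec x)) *
        Real.log (|T.det|⁻¹ * ρ (T⁻¹.mulVec x))) := by
      funext x
      simp only [Pi.sub_apply]
      by_cases h0 : ρ (T⁻¹.mulVec x) = 0
      · simp [h0]
      · rw [Real.log_mul (inv_pos.mpr hd).ne' h0, Real.log_inv]
        ring
    rw [e] at hc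
    refine ⟨hc.1, hc.2.trans ?_⟩
    simp only [Pi.sub_apply]
    rw [integral_sub h.2.2.2.2 h1, integral_const_mul, h.2.2.1, mul_one]
  have hmeas : Measurable (fun x : Fin n → ℝ => T⁻¹.mulVec x) := by fun_prop
  refine ⟨fun x => |T.det|⁻¹ * ρ (T⁻¹.mulVec x), ⟨(h.1.comp hmeas).const_mul _,
    fun x => mul_nonneg (inv_pos.mpr hd).le (h.2.1 _), ?_, fun i j => ?_, hent.1⟩, ?_, ?_, hf⟩
  · rw [(cov hT hρi).2, h.2.2.1]
  · exact (hf (fun x => x i * x j) (hmom i j).1).1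
  · ext i j
    rw [← (hmom i j).2]
    exact (hf (fun x => x i * x j) (hmom i j).1).2
  · unfold entropy
    rw [hent.2]
    ring

lemma F_bdd {n : ℕ} (W : (Fin n → ℝ) → ℝ) (hW : ∀ x, 0 ≤ W x) (M : Matrix (Fin n) (Fin n) ℝ) :
    BddAbove { r : ℝ | ∃ ρ : (Fin n → ℝ) → ℝ, IsGoodDensity ρ ∧
    (Integrable fun x => W x * ρ x) ∧ momMatrix ρ = M ∧
    r = entropy ρ - ∫ x, W x * ρ x } := by
  refine ⟨Real.log (∫ x, gau (1 : Matrix (Fin n) (Fin n) ℝ) x) +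
    (1 / 2) * ∑ i, ∑ j, (1 : Matrix (Fin n) (Fin n) ℝ) i j * M i j, ?_⟩
  rintro r ⟨ρ, hρ, hi, hM, rfl⟩
  have h0 : Integrable (fun x => (fun _ : Fin n → ℝ => (0:ℝ)) x * ρ x) := by simp
  have := ent_bound (P := (1 : Matrix (Fin n) (Fin n) ℝ)) Matrix.PosDef.one hρ (PB.const 0)
    (fun _ => le_refl _) h0 (le_refl (0:ℝ))
  have h2 : 0 ≤ ∫ x, W x * ρ x := integral_nonneg fun x => mul_nonneg (hW x) (hρ.2.1 x)
  rw [hM] at this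
  simp only [zero_mul, ne_eq, OfNat.ofNat_ne_zero, not_false_eq_true, zero_pow, zero_div, add_zero] at this
  linarith

set_option maxHeartbeats 2000000 in
lemma core {n : ℕ} {v : Matrix (Fin n) (Fin n) ℝ} (hv : v.IsSymm) (hU : SuperQuadratic (quart v))
    {G : Matrix (Fin n) (Fin n) ℝ} (hG : G.PosDef) (A : Matrix (Fin n) (Fin n) ℝ) :
    ∃ C : ℝ, ∀ ε : ℝ, 0 < ε → ∃ K t0 : ℝ, 0 < t0 ∧ ∀ t : ℝ, 0 < t → t < t0 →
      t * (-2 * ε * ev G⁻¹ (dU v A) - ε ^ 2 * C) - t ^ 2 * K ≤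
        Phi n (fun x => ε * quart v x) ((1 + t • A) * G * (1 + t • A)ᵀ) -
          Phi n (fun x => ε * quart v x) G := by
  obtain ⟨c, hc, hlow⟩ := quart_lower hU (quart_hom v)
  obtain ⟨K1, hK1, hdU⟩ := dU_bound v A
  obtain ⟨K0, hK0, hexp⟩ := quart_expand hv A
  obtain ⟨Kq, hKq, hqb⟩ := quart_bound v
  obtain ⟨a, ha, hA⟩ := mulVec_bound A
  have hU0 : ∀ x, 0 ≤ quart v x := fun x => le_trans (by positivity) (hlow x)
  have hn4 : ∀ x : Fin n → ℝ, ‖x‖ ^ 4 ≤ quart v x / c := fun x => by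
    rw [le_div_iff₀ hc, mul_comm]; exact hlow x
  obtain ⟨η, hη, hηc⟩ : ∃ η : ℝ, 0 < η ∧ η * K1 ≤ c := by
    refine ⟨c / (K1 + 1), by positivity, ?_⟩
    rw [div_mul_eq_mul_div, div_le_iff₀ (by positivity)]
    nlinarith
  let q : (Fin n → ℝ) → ℝ := fun x => quart v x + (-η) * dU v A x
  have hq : PB q := (PB.quart v).add ((PB.const _).mul (PB.dU v A))
  have hq0 : ∀ x, 0 ≤ q x := fun x => by
    have h1 := (abs_le.mp (hdU x)).2
    have h2 : η * dU v A x ≤ η * (K1 * ‖x‖ ^ 4) := mul_le_mul_of_nonneg_left h1 hη.le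
    have h3 : (η * K1) * ‖x‖ ^ 4 ≤ c * ‖x‖ ^ 4 := mul_le_mul_of_nonneg_right hηc (by positivity)
    have := hlow x
    show 0 ≤ quart v x + (-η) * dU v A x
    nlinarith
  have hP := hG.inv
  have hevq : ev G⁻¹ q = ev G⁻¹ (quart v) - η * ev G⁻¹ (dU v A) := by
    show ev G⁻¹ (fun x => quart v x + (-η) * dU v A x) = _
    rw [ev_add hP (PB.quart v) ((PB.const _).mul (PB.dU v A)), ev_smul]
    ring
  obtain ⟨γ, hγ, hγm, hγe, hγf⟩ := gauss_good hG
  set D := (1 / 2) * ev G⁻¹ (fun x => q x ^ 2) with hD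
  refine ⟨2 * D / η, fun ε hε => ?_⟩
  set eU := ev G⁻¹ (quart v) with heU
  set ed := ev G⁻¹ (dU v A) with hed
  have hdet : ∀ᶠ t : ℝ in 𝓝 0, (1 + t • A).det ≠ 0 := by
    have hcont : Continuous (fun t : ℝ => (1 + t • A).det) := by fun_prop
    exact hcont.continuousAt.eventually_ne (by simp)
  obtain ⟨r, hr, hrd⟩ := Metric.eventually_nhds_iff.mp hdet
  refine ⟨2 / η + 2 * (K0 / c) * (ε * eU + 1) + 2, min r 1, lt_min hr one_pos, fun t ht htr => ?_⟩
  have ht1 : t ≤ 1 := (htr.trans_le (min_le_right _ _)).le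
  have hTd : (1 + t • A).det ≠ 0 := hrd (by
    rw [Real.dist_eq, sub_zero, abs_of_pos ht]; exact htr.trans_le (min_le_left _ _))
  set W : (Fin n → ℝ) → ℝ := fun x => ε * quart v x with hW
  have hW0 : ∀ x, 0 ≤ W x := fun x => mul_nonneg hε.le (hU0 x)
  set Sg := Real.log (∫ x, gau G⁻¹ x) + (1 / 2) * ∑ i, ∑ j, G⁻¹ i j * G i j with hSg
  have hWint : ∀ ρ : (Fin n → ℝ) → ℝ, ∫ x, W x * ρ x = ε * ∫ x, quart v x * ρ x := fun ρ => by
    simp only [hW, mul_assoc, integral_const_mul]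
  have hWi : ∀ ρ : (Fin n → ℝ) → ℝ, Integrable (fun x => quart v x * ρ x) →
      Integrable (fun x => W x * ρ x) := fun ρ h => by
    simp only [hW, mul_assoc]; exact h.const_mul _
  have hmemg : Sg - ε * eU ∈ { r : ℝ | ∃ ρ : (Fin n → ℝ) → ℝ, IsGoodDensity ρ ∧
      (Integrable fun x => W x * ρ x) ∧ momMatrix ρ = G ∧
      r = entropy ρ - ∫ x, W x * ρ x } :=
    ⟨γ, hγ, hWi _ (hγf _ (PB.quart v)).1, hγm, by
      rw [hWint, (hγf _ (PB.quart v)).2, hγe]⟩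
  have hFg : Sg - ε * eU ≤ Ffun n W G := le_csSup (F_bdd W hW0 G) hmemg
  obtain ⟨_, ⟨ρ, hρ, hρi, hρm, rfl⟩, hlt⟩ := exists_lt_of_lt_csSup ⟨_, hmemg⟩
    (show Ffun n W G - t ^ 2 < Ffun n W G by nlinarith [sq_pos_of_pos ht])
  have hUi : Integrable (fun x => quart v x * ρ x) := by
    refine (hρi.const_mul ε⁻¹).congr (ae_of_all _ fun x => ?_)
    simp only [hW]; field_simp
  rw [hWint] at hlt
  have hdom : ∀ f : (Fin n → ℝ) → ℝ, Continuous f → ∀ k : ℝ, (∀ x, |f x| ≤ k * quart v x) →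
      Integrable (fun x => f x * ρ x) := fun f hf k hk => by
    refine (hUi.const_mul k).mono' (hf.measurable.mul hρ.1).aestronglyMeasurable
      (ae_of_all _ fun x => ?_)
    rw [Real.norm_eq_abs, abs_mul, abs_of_nonneg (hρ.2.1 x), ← mul_assoc]
    exact mul_le_mul_of_nonneg_right (hk x) (hρ.2.1 x)
  have hdi : Integrable (fun x => dU v A x * ρ x) := hdom _ (PB.dU v A).1 (K1 / c) fun x => by
    refine (hdU x).trans ((mul_le_mul_of_nonneg_left (hn4 x) hK1).trans_eq ?_)
    ring
  set E := ∫ x, quart v x * ρ x with hE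
  set Ed := ∫ x, dU v A x * ρ x with hEd
  have hE0 : 0 ≤ E := integral_nonneg fun x => mul_nonneg (hU0 x) (hρ.2.1 x)
  have hqρ : Integrable (fun x => q x * ρ x) ∧ ∫ x, q x * ρ x = E - η * Ed := by
    have := lin3 hUi hdi hdi 1 (-η) 0
    have e : (fun x => 1 * (quart v x * ρ x) + -η * (dU v A x * ρ x) + 0 * (dU v A x * ρ x)) =
        fun x => q x * ρ x := by
      funext x; simp only [q]; ring
    rw [e] at this
    refine ⟨this.1, this.2.trans ?_⟩
    ring
  have hb0 := ent_bound hP hρ hq hq0 hqρ.1 (le_refl (0:ℝ))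
  have hb1 := ent_bound hP hρ hq hq0 hqρ.1 hε.le
  rw [hρm, ← hSg, hqρ.2, hevq] at hb0 hb1
  have hx1 : ε * E ≤ ε * eU + t ^ 2 := by nlinarith
  have hx2 : η * (ε * Ed) ≤ η * (ε * ed) + t ^ 2 + ε ^ 2 * D := by
    rw [hD]; nlinarith
  have hTv : ∀ x, (1 + t • A).mulVec x = x + t • A.mulVec x := fun x => by
    rw [Matrix.add_mulVec, Matrix.one_mulVec, Matrix.smul_mulVec]
  obtain ⟨ρ', hρ', hm', he', hf'⟩ := push_good hTd hρ
  have hTU : Integrable (fun x => quart v ((1 + t • A).mulVec x) * ρ x) := by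
    have hcont : Continuous (fun x => quart v ((1 + t • A).mulVec x)) :=
      (PB.quart v).1.comp (by fun_prop)
    refine hdom _ hcont (Kq * (1 + a) ^ 4 / c) fun x => ?_
    have h1 : ‖(1 + t • A).mulVec x‖ ≤ (1 + a) * ‖x‖ := by
      rw [hTv]
      refine (norm_add_le _ _).trans ?_
      rw [norm_smul, Real.norm_eq_abs, abs_of_pos ht]
      have := hA x
      have h3 : t * ‖A.mulVec x‖ ≤ 1 * ‖A.mulVec x‖ :=
        mul_le_mul_of_nonneg_right ht1 (norm_nonneg _)
      linarith
    have h2 : ‖(1 + t • A).mulVec x‖ ^ 4 ≤ ((1 + a) * ‖x‖) ^ 4 :=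
      pow_le_pow_left₀ (norm_nonneg _) h1 4
    calc _ ≤ Kq * ‖(1 + t • A).mulVec x‖ ^ 4 := hqb _
      _ ≤ Kq * ((1 + a) * ‖x‖) ^ 4 := mul_le_mul_of_nonneg_left h2 hKq
      _ = (Kq * (1 + a) ^ 4) * ‖x‖ ^ 4 := by ring
      _ ≤ (Kq * (1 + a) ^ 4) * (quart v x / c) :=
        mul_le_mul_of_nonneg_left (hn4 x) (by positivity)
      _ = _ := by ring
  obtain ⟨hi', hI'⟩ := hf' _ hTU
  have hET : ∫ x, quart v ((1 + t • A).mulVec x) * ρ x ≤ E + t * Ed + t ^ 2 * (K0 / c) * E := by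
    have h3 := lin3 hUi hdi hUi 1 t (t ^ 2 * (K0 / c))
    calc _ ≤ ∫ x, (1 * (quart v x * ρ x) + t * (dU v A x * ρ x) +
          (t ^ 2 * (K0 / c)) * (quart v x * ρ x)) := by
          refine integral_mono hTU h3.1 fun x => ?_
          have h4 := hexp t x ht.le ht1
          rw [← hTv] at h4
          have h5 : t ^ 2 * (K0 * ‖x‖ ^ 4) ≤ t ^ 2 * (K0 * (quart v x / c)) :=
            mul_le_mul_of_nonneg_left (mul_le_mul_of_nonneg_left (hn4 x) hK0) (by positivity)
          have h6 := mul_le_mul_of_nonneg_right (h4.trans (add_le_add_right h5 _)) (hρ.2.1 x)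
          refine h6.trans_eq ?_
          ring
      _ = _ := by rw [h3.2]; ring
  have hFT : entropy ρ + Real.log |(1 + t • A).det| -
      ε * ∫ x, quart v ((1 + t • A).mulVec x) * ρ x ≤
      Ffun n W ((1 + t • A) * G * (1 + t • A)ᵀ) := by
    refine le_csSup (F_bdd W hW0 _) ⟨ρ', hρ', hWi _ hi', by rw [hm', hρm], ?_⟩
    rw [hWint, hI', he']
  have hlog : Real.log ((1 + t • A) * G * (1 + t • A)ᵀ).det =
      2 * Real.log |(1 + t • A).det| + Real.log G.det := by
    rw [Matrix.det_mul, Matrix.det_mul, Matrix.det_transpose, Real.log_mul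
      (mul_ne_zero hTd hG.det_pos.ne') hTd, Real.log_mul hTd hG.det_pos.ne', Real.log_abs]
    ring
  unfold Phi
  rw [hlog]
  have hx3 : ε * (∫ x, quart v ((1 + t • A).mulVec x) * ρ x) ≤
      ε * E + t * (ε * Ed) + t ^ 2 * (K0 / c) * (ε * E) := by
    refine (mul_le_mul_of_nonneg_left hET hε.le).trans_eq ?_
    ring
  have hx4 : ε * Ed ≤ ε * ed + t ^ 2 / η + ε ^ 2 * D / η := by
    have : ε * Ed ≤ (η * (ε * ed) + t ^ 2 + ε ^ 2 * D) / η := by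
      rw [le_div_iff₀ hη]; linarith
    refine this.trans_eq ?_
    field_simp
  have hx5 : t * (ε * Ed) ≤ t * (ε * ed + t ^ 2 / η + ε ^ 2 * D / η) :=
    mul_le_mul_of_nonneg_left hx4 ht.le
  have ht2 : t ^ 2 ≤ 1 := pow_le_one₀ ht.le ht1
  have hx6 : t ^ 2 * (K0 / c) * (ε * E) ≤ t ^ 2 * (K0 / c) * (ε * eU + 1) :=
    mul_le_mul_of_nonneg_left (by linarith) (by positivity)
  have hx7 : t * (t ^ 2 / η) ≤ t ^ 2 / η := by
    have : 0 ≤ t ^ 2 / η := by positivity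
    nlinarith
  have hx8 : t * (-2 * ε * ed - ε ^ 2 * (2 * D / η)) - t ^ 2 * (2 / η + 2 * (K0 / c) * (ε * eU + 1) + 2)
      = -2 * (t * (ε * ed) + t * (ε ^ 2 * D / η)) - 2 * (t ^ 2 / η) -
        2 * (t ^ 2 * (K0 / c) * (ε * eU + 1)) - 2 * t ^ 2 := by
    ring
  rw [hx8]
  have hx9 : t * (ε * ed + t ^ 2 / η + ε ^ 2 * D / η) =
      t * (ε * ed) + t * (t ^ 2 / η) + t * (ε ^ 2 * D / η) := by ring
  linarith

lemma curve_deriv {n : ℕ} (G H B : Matrix (Fin n) (Fin n) ℝ) :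
    HasDerivAt (fun t : ℝ => G + t • H + t ^ 2 • B) H 0 := by
  have h1 := ((hasDerivAt_id' (0:ℝ)).smul_const H).const_add G
  have h2 := (hasDerivAt_pow 2 (0:ℝ)).smul_const B
  exact (h1.add h2).congr_deriv (by simp)

lemma slope_lower {g : ℝ → ℝ} {d b K t0 : ℝ} (hg : HasDerivAt g d 0) (ht0 : 0 < t0)
    (h : ∀ t, 0 < t → t < t0 → t * b - t ^ 2 * K ≤ g t - g 0) : b ≤ d := by
  have h1 : Tendsto (slope g 0) (𝓝[>] 0) (𝓝 d) :=
    hg.tendsto_slope.mono_left (nhdsWithin_mono _ fun x hx => ne_of_gt hx)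
  have h2 : Tendsto (fun t : ℝ => b - t * K) (𝓝[>] 0) (𝓝 b) := by
    have : Continuous (fun t : ℝ => b - t * K) := by fun_prop
    have := (this.tendsto 0).mono_left (nhdsWithin_le_nhds (s := Set.Ioi 0))
    simpa using this
  refine le_of_tendsto_of_tendsto h2 h1 ?_
  filter_upwards [Ioo_mem_nhdsGT ht0] with t ht
  have := h t ht.1 ht.2
  rw [slope_def_field, sub_zero, le_div_iff₀ ht.1]
  linarith

lemma half_bound {n : ℕ} {v : Matrix (Fin n) (Fin n) ℝ} (hv : v.IsSymm)
    (hU : SuperQuadratic (quart v))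
    {G : Matrix (Fin n) (Fin n) ℝ} (hG : G.PosDef)
    {Sig : ℝ → Matrix (Fin n) (Fin n) ℝ}
    (hSig : ∀ ε : ℝ, 0 < ε →
      HasFDerivWithinAt (Phi n (fun x => ε * quart v x)) (tracePairing (Sig ε))
        {M : Matrix (Fin n) (Fin n) ℝ | M.IsSymm} G)
    {S1 : Matrix (Fin n) (Fin n) ℝ}
    (hO : (fun ε : ℝ => Sig ε - ε • S1) =O[𝓝[>] (0 : ℝ)] fun ε => ε ^ 2)
    {H : Matrix (Fin n) (Fin n) ℝ} (hH : H.IsSymm) :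
    -2 * ev G⁻¹ (dU v ((1 / 2 : ℝ) • (H * G⁻¹))) ≤ (S1 * H).trace := by
  have hu : IsUnit G.det := (Matrix.isUnit_iff_isUnit_det _).mp hG.isUnit
  have hGs : Gᵀ = G := by simpa using hG.isHermitian.eq
  have hHs : Hᵀ = H := hH
  obtain ⟨A, hAdef⟩ : ∃ A, A = (1 / 2 : ℝ) • (H * G⁻¹) := ⟨_, rfl⟩
  rw [← hAdef]
  have hAG : A * G = (1 / 2 : ℝ) • H := by
    rw [hAdef, Matrix.smul_mul, Matrix.mul_assoc, Matrix.nonsing_inv_mul _ hu, Matrix.mul_one]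
  have hGA : G * Aᵀ = (1 / 2 : ℝ) • H := by
    have := congrArg Matrix.transpose hAG
    rwa [Matrix.transpose_mul, hGs, Matrix.transpose_smul, hHs] at this
  have hcurve : ∀ t : ℝ, (1 + t • A) * G * (1 + t • A)ᵀ = G + t • H + t ^ 2 • (A * G * Aᵀ) := by
    intro t
    have h1 : (1 + t • A) * G * (1 + t • A)ᵀ =
        G + t • (A * G) + (t • (G * Aᵀ) + t ^ 2 • (A * G * Aᵀ)) := by
      simp only [Matrix.transpose_add, Matrix.transpose_one, Matrix.transpose_smul, Matrix.add_mul,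
        Matrix.one_mul, Matrix.smul_mul, Matrix.mul_add, Matrix.mul_one, Matrix.mul_smul,
        smul_smul, pow_two, smul_add]
    have h2 : t • H = t • (1 / 2 : ℝ) • H + t • (1 / 2 : ℝ) • H := by
      rw [smul_smul, ← add_smul]; congr 1; ring
    rw [h1, hGA, hAG, h2]
    abel
  obtain ⟨C, hC⟩ := core hv hU hG A
  set e := ev G⁻¹ (dU v A) with he
  have hstep : ∀ ε : ℝ, 0 < ε → -2 * ε * e - ε ^ 2 * C ≤ (Sig ε * H).trace := by
    intro ε hε
    obtain ⟨K, t0, ht0, hb⟩ := hC ε hε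
    have hsym : ∀ t : ℝ, G + t • H + t ^ 2 • (A * G * Aᵀ) ∈
        {M : Matrix (Fin n) (Fin n) ℝ | M.IsSymm} := fun t => by
      show (G + t • H + t ^ 2 • (A * G * Aᵀ))ᵀ = _
      simp only [Matrix.transpose_add, Matrix.transpose_smul, Matrix.transpose_mul,
        Matrix.transpose_transpose, hGs, hHs, Matrix.mul_assoc]
    have h0 : G = G + (0:ℝ) • H + (0:ℝ) ^ 2 • (A * G * Aᵀ) := by simp
    have hf := hSig ε hε
    have hd : HasDerivAt (fun t : ℝ => Phi n (fun x => ε * quart v x)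
        (G + t • H + t ^ 2 • (A * G * Aᵀ))) ((Sig ε * H).trace) 0 := by
      have hf2 : HasFDerivWithinAt (Phi n (fun x => ε * quart v x)) (tracePairing (Sig ε))
        {M : Matrix (Fin n) (Fin n) ℝ | M.IsSymm} (G + (0:ℝ) • H + (0:ℝ) ^ 2 • (A * G * Aᵀ)) := by
        rw [← h0]; exact hf
      exact HasFDerivWithinAt.comp_hasDerivAt (0:ℝ) hf2 (curve_deriv G H (A * G * Aᵀ))
        (Eventually.of_forall hsym)
    refine slope_lower hd ht0 (K := K) fun t ht1 ht2 => ?_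
    have := hb t ht1 ht2
    rw [hcurve] at this
    rw [← h0]
    exact this
  have hO2 : (fun ε : ℝ => tracePairing H (Sig ε - ε • S1)) =O[𝓝[>] (0 : ℝ)] fun ε => ε ^ 2 :=
    ((tracePairing H).isBigO_comp _ _).trans hO
  obtain ⟨c, hc⟩ := hO2.bound
  have h2 : Tendsto (fun ε : ℝ => -2 * e - ε * (C + c)) (𝓝[>] 0) (𝓝 (-2 * e)) := by
    have : Continuous (fun ε : ℝ => -2 * e - ε * (C + c)) := by fun_prop
    have := (this.tendsto 0).mono_left (nhdsWithin_le_nhds (s := Set.Ioi 0))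
    simpa using this
  refine le_of_tendsto h2 ?_
  filter_upwards [hc, self_mem_nhdsWithin] with ε h3 hε
  have hε : 0 < ε := hε
  have h4 : tracePairing H (Sig ε - ε • S1) = (Sig ε * H).trace - ε * (S1 * H).trace := by
    show (H * (Sig ε - ε • S1)).trace = _
    rw [Matrix.trace_mul_comm, Matrix.sub_mul, Matrix.smul_mul, Matrix.trace_sub,
      Matrix.trace_smul, smul_eq_mul]
  rw [h4, Real.norm_eq_abs, Real.norm_eq_abs, abs_of_pos (by positivity : 0 < ε ^ 2)] at h3
  have h5 := (abs_le.mp h3).2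
  have h6 := hstep ε hε
  have h7 : ε * (-2 * e - ε * (C + c)) ≤ ε * (S1 * H).trace := by nlinarith
  exact le_of_mul_le_mul_left h7 hε

/-- First-order bold self-energy coefficient: for the quartic interaction
`U(x) = (1/8) Σ_{ij} v_{ij} x_i² x_j²` with symmetric `v` and superquadratic growth and
`G ≻ 0`, the first coefficient of the asymptotic series of `ε ↦ Σ[G; εU]` is
`(Σ^(1))_{ij} = -½ (Σ_k v_{ik} G_{kk}) δ_{ij} - v_{ij} G_{ij}`. -/
theorem statement16 (n : ℕ) (hn : 1 ≤ n)
    (v : Matrix (Fin n) (Fin n) ℝ) (hv : v.IsSymm)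
    (U : (Fin n → ℝ) → ℝ)
    (hUdef : U = fun x => (1 / 8) * ∑ i, ∑ j, v i j * (x i) ^ 2 * (x j) ^ 2)
    (hU : SuperQuadratic U)
    (G : Matrix (Fin n) (Fin n) ℝ) (hG : G.PosDef)
    (Sig : ℝ → Matrix (Fin n) (Fin n) ℝ)
    (hSig : ∀ ε : ℝ, 0 < ε → (Sig ε).IsSymm ∧
      HasFDerivWithinAt (Phi n (fun x => ε * U x)) (tracePairing (Sig ε))
        {M : Matrix (Fin n) (Fin n) ℝ | M.IsSymm} G)
    (S : ℕ → Matrix (Fin n) (Fin n) ℝ)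
    (hSsymm : ∀ k, (S k).IsSymm)
    (hSigAsymp : ∀ N : ℕ,
      (fun ε : ℝ => Sig ε - ∑ k ∈ Finset.Icc 1 N, ε ^ k • S k)
        =O[𝓝[>] (0 : ℝ)] fun ε => ε ^ (N + 1)) :
    ∀ i j : Fin n, S 1 i j =
      -(1 / 2) * (∑ k, v i k * G k k) * (if i = j then 1 else 0) - v i j * G i j := by
  have hUq : U = quart v := hUdef
  rw [hUq] at hU hSig
  have hO : (fun ε : ℝ => Sig ε - ε • S 1) =O[𝓝[>] (0 : ℝ)] fun ε => ε ^ 2 := by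
    simpa using hSigAsymp 1
  have hGs : ∀ i j, G j i = G i j := fun i j => by
    have : Gᵀ = G := by simpa using hG.isHermitian.eq
    exact congrFun (congrFun this i) j
  have hkey : ∀ H : Matrix (Fin n) (Fin n) ℝ, H.IsSymm →
      (S 1 * H).trace = -((1 / 2) * ∑ i, (∑ k, v i k * G k k) * H i i +
        ∑ i, ∑ j, v i j * G i j * H i j) := by
    intro H hH
    have h1 := half_bound hv hU hG (fun ε hε => (hSig ε hε).2) hO hH
    have h2 := half_bound hv hU hG (fun ε hε => (hSig ε hε).2) hO (H := -H)
      (by show (-H)ᵀ = -H; rw [Matrix.transpose_neg, hH])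
    have e1 := ev_dU hG v H
    have e2 : ev G⁻¹ (dU v ((1 / 2 : ℝ) • (-H * G⁻¹))) =
        - ev G⁻¹ (dU v ((1 / 2 : ℝ) • (H * G⁻¹))) := by
      have : dU v ((1 / 2 : ℝ) • (-H * G⁻¹)) =
          fun x => (-1) * dU v ((1 / 2 : ℝ) • (H * G⁻¹)) x := by
        funext x
        rw [Matrix.neg_mul, smul_neg, dU_neg]
        ring
      rw [this, ev_smul]
      ring
    rw [e2, Matrix.mul_neg, Matrix.trace_neg] at h2
    linarith
  let M : Matrix (Fin n) (Fin n) ℝ := Matrix.of fun i j =>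
    -(1 / 2) * (∑ k, v i k * G k k) * (if i = j then 1 else 0) - v i j * G i j
  have hM : Mᵀ = M := by
    ext i j
    simp only [M, Matrix.transpose_apply, Matrix.of_apply]
    rw [hGs, show v j i = v i j from congrFun (congrFun hv i) j]
    by_cases hij : i = j
    · subst hij; rfl
    · rw [if_neg hij, if_neg (Ne.symm hij)]; ring
  have hMtr : ∀ H : Matrix (Fin n) (Fin n) ℝ, H.IsSymm →
      (M * H).trace = -((1 / 2) * ∑ i, (∑ k, v i k * G k k) * H i i +
        ∑ i, ∑ j, v i j * G i j * H i j) := by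
    intro H hH
    simp only [Matrix.trace, Matrix.diag_apply, Matrix.mul_apply]
    rw [Finset.mul_sum, ← Finset.sum_add_distrib, ← Finset.sum_neg_distrib]
    refine Finset.sum_congr rfl fun i _ => ?_
    have : ∀ j, M i j * H j i = (if i = j then -(1 / 2) * (∑ k, v i k * G k k) * H i j else 0) -
        v i j * G i j * H i j := fun j => by
      rw [show H j i = H i j from congrFun (congrFun hH i) j]
      simp only [M, Matrix.of_apply]
      split_ifs <;> ring
    simp only [this]
    rw [Finset.sum_sub_distrib, Finset.sum_ite_eq, if_pos (Finset.mem_univ _)]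
    ring
  have hsub : (S 1 - M)ᵀ = S 1 - M := by rw [Matrix.transpose_sub, hM, hSsymm 1]
  have hz : ((S 1 - M)ᴴ * (S 1 - M)).trace = 0 := by
    rw [Matrix.conjTranspose_eq_transpose_of_trivial, hsub]
    conv_lhs => rw [Matrix.sub_mul]
    rw [Matrix.trace_sub, hkey _ hsub, hMtr _ hsub, sub_self]
  have hfin := sub_eq_zero.mp (Matrix.trace_conjTranspose_mul_self_eq_zero_iff.mp hz)
  intro i j
  rw [hfin]
  rfl
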